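/- Let X be a Hausdorff topological space, C a set of convergent nets in X, and 𝔗 a Hausdorff topology on C satisfying the transposition property such that the limit map lim : (C, 𝔗) → X is continuous. Let D and D₀ be directed sets and (x_{d,δ})_{d∈D₀, δ∈D} a doubly indexed family in X such that for each δ ∈ D the row net S_δ = (x_{d,δ})_{d∈D₀} belongs to C and the net δ ↦ S_δ 𝔗-converges in C. Then both iterated limits exist and are equal: lim_{δ} (lim_{d} x_{d,δ}) = lim_{d} (lim_{δ} x_{d,δ}). -/

import Mathlib

universe u

/-- A net in `X`: a function from a (nonempty) directed index set into `X`,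
bundled as a dependent pair. -/
structure Net (X : Type u) : Type (u + 1) where
  ι : Type u
  [pre : Preorder ι]
  [ne : Nonempty ι]
  [dir : IsDirected ι (· ≤ ·)]
  toFun : ι → X

/-- Convergence of a net to a point: the underlying function tends to the
neighbourhood filter of the point along `atTop`. -/
def Net.Conv {X : Type u} [TopologicalSpace X] (S : Net X) (x : X) : Prop :=
  letI := S.pre
  Filter.Tendsto S.toFun Filter.atTop (nhds x)

/-- Bundle a function on a directed set as a net. -/
def Net.mk' {X : Type u} (D₀ : Type u) [Preorder D₀] [Nonempty D₀]
    [IsDirected D₀ (· ≤ ·)] (f : D₀ → X) : Net X :=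
  ⟨D₀, f⟩

/-- Image of a net under a map (the arrow-map of the net functor `𝔑`). -/
def Net.map {X Y : Type u} (f : X → Y) (S : Net X) : Net Y :=
  letI := S.pre; letI := S.ne; letI := S.dir
  ⟨S.ι, f ∘ S.toFun⟩

/-- A topology `𝔗` on a set `C` of nets in `X` satisfies the *transposition
property* if for every directed set `D` and every `𝔗`-convergent net
`𝔖 : D → C` whose members all share a common index set `D₀` (a doubly
indexed family `x : D₀ → D → X`), each column net `δ ↦ x d δ` converges in
`X`, and the net of these limits `d ↦ lim_δ x d δ` is precisely the
`𝔗`-limit of `𝔖`. -/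
def HasTransposition {X : Type u} [TopologicalSpace X]
    (C : Set (Net X)) (𝔗 : TopologicalSpace ↥C) : Prop :=
  ∀ (D : Type (u + 1)) [Preorder D] [Nonempty D] [IsDirected D (· ≤ ·)]
    (D₀ : Type u) [Preorder D₀] [Nonempty D₀] [IsDirected D₀ (· ≤ ·)]
    (x : D₀ → D → X) (𝔖 : D → ↥C) (S₀ : ↥C),
    (∀ δ, (𝔖 δ : Net X) = Net.mk' D₀ (fun d => x d δ)) →
    Filter.Tendsto 𝔖 Filter.atTop (@nhds ↥C 𝔗 S₀) →
    ∃ y : D₀ → X,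
      (∀ d, Filter.Tendsto (fun δ => x d δ) Filter.atTop (nhds (y d))) ∧
      (S₀ : Net X) = Net.mk' D₀ y

theorem Net.conv_mk' {X : Type u} [TopologicalSpace X] {D₀ : Type u} [Preorder D₀]
    [Nonempty D₀] [IsDirected D₀ (· ≤ ·)] {f : D₀ → X} {a : X} :
    (Net.mk' D₀ f).Conv a ↔ Filter.Tendsto f Filter.atTop (nhds a) :=
  Iff.rfl

/-- Let `X` be Hausdorff, `C` a set of convergent nets in `X`, and
`𝔗` a Hausdorff topology on `C` with the transposition property such that the
limit map `lim : (C,𝔗) → X` is continuous.  If `(x_{d,δ})_{d ∈ D₀, δ ∈ D}` is a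
doubly indexed family whose rows `S_δ = (x_{d,δ})_{d ∈ D₀}` lie in `C` and the
net `δ ↦ S_δ` `𝔗`-converges in `C`, then both iterated limits exist and are
equal: `lim_δ lim_d x_{d,δ} = lim_d lim_δ x_{d,δ}`. -/
theorem iterated_limits_commute {X : Type u} [TopologicalSpace X] [T2Space X]
    (C : Set (Net X)) (hC : ∀ S ∈ C, ∃ x, Net.Conv S x)
    (𝔗 : TopologicalSpace ↥C) (h𝔗 : @T2Space ↥C 𝔗)
    (htr : HasTransposition C 𝔗)
    (limC : ↥C → X) (hlim : ∀ S : ↥C, (S : Net X).Conv (limC S))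
    (hlimcont : @Continuous ↥C X 𝔗 _ limC)
    (D : Type (u + 1)) [Preorder D] [Nonempty D] [IsDirected D (· ≤ ·)]
    (D₀ : Type u) [Preorder D₀] [Nonempty D₀] [IsDirected D₀ (· ≤ ·)]
    (x : D₀ → D → X) (𝔖 : D → ↥C) (S₀ : ↥C)
    (hrows : ∀ δ, (𝔖 δ : Net X) = Net.mk' D₀ (fun d => x d δ))
    (hconv : Filter.Tendsto 𝔖 Filter.atTop (@nhds ↥C 𝔗 S₀)) :
    ∃ (a : X) (z : D → X) (y : D₀ → X),
      (∀ δ, Filter.Tendsto (fun d => x d δ) Filter.atTop (nhds (z δ))) ∧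
      (∀ d, Filter.Tendsto (fun δ => x d δ) Filter.atTop (nhds (y d))) ∧
      Filter.Tendsto z Filter.atTop (nhds a) ∧
      Filter.Tendsto y Filter.atTop (nhds a) := by
  obtain ⟨y, hy, hS₀⟩ := htr D D₀ x 𝔖 S₀ hrows hconv
  exact ⟨limC S₀, limC ∘ 𝔖, y, fun δ => Net.conv_mk'.mp (hrows δ ▸ hlim (𝔖 δ)), hy,
    (hlimcont.tendsto S₀).comp hconv, Net.conv_mk'.mp (hS₀ ▸ hlim S₀)⟩
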